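/- arXiv:2311.15321 — 2 statements merged into one kernel-verified Lean document; each statement's English description precedes it below -/
import Mathlib

section
/- Let Γ be an unbalanced signed graph of order n ≥ 5. If λ₁(Γ) ≥ λ₁(Γ₁), where Γ₁ = C₃⁻ • K_{n−2}, then Γ contains a negative 4-cycle, unless Γ is switching equivalent to Γ₁. -/
/-- The largest eigenvalue (index) of a real symmetric matrix. -/
noncomputable def lam1 {n : ℕ} (A : Matrix (Fin n) (Fin n) ℝ) (hA : A.IsHermitian) : ℝ :=
  ⨆ i, hA.eigenvalues i

/-- The sign of a walk in a signed graph: the product of the edge signs along the walk. -/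
def walkSign {V : Type*} {G : SimpleGraph V} (σ : V → V → ℝ) {u v : V} (p : G.Walk u v) : ℝ :=
  (p.darts.map fun d => σ d.toProd.1 d.toProd.2).prod

/-- The adjacency matrix of the signed graph `Γ₁ = C₃⁻ • K_{n−2}`: vertices `0` and `1` are
joined by a negative edge, both are joined positively to vertex `2`, the vertices
`2, 3, …, n−1` form an all-positive clique, and there are no other edges. -/
def gamma1 (n : ℕ) : Matrix (Fin n) (Fin n) ℝ := fun i j =>
  if i = j then 0
  else if (i.val = 0 ∧ j.val = 1) ∨ (i.val = 1 ∧ j.val = 0) then -1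
  else if (i.val ≤ 1 ∧ j.val = 2) ∨ (j.val ≤ 1 ∧ i.val = 2) then 1
  else if 2 ≤ i.val ∧ 2 ≤ j.val then 1
  else 0

theorem posSemidef_lam1_smul_one_sub {n : ℕ} (A : Matrix (Fin n) (Fin n) ℝ) (hA : A.IsHermitian) :
    (lam1 A hA • (1 : Matrix (Fin n) (Fin n) ℝ) - A).PosSemidef := by
  have h1 : lam1 A hA • (1 : Matrix (Fin n) (Fin n) ℝ) - A =
      (hA.eigenvectorUnitary : Matrix (Fin n) (Fin n) ℝ) *
        Matrix.diagonal (fun i => lam1 A hA - hA.eigenvalues i) *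
        (hA.eigenvectorUnitary : Matrix (Fin n) (Fin n) ℝ).conjTranspose := by
    have hs := hA.spectral_theorem
    rw [Unitary.conjStarAlgAut_apply] at hs
    have hU : (hA.eigenvectorUnitary : Matrix (Fin n) (Fin n) ℝ) *
        (hA.eigenvectorUnitary : Matrix (Fin n) (Fin n) ℝ).conjTranspose = 1 :=
      Unitary.coe_mul_star_self hA.eigenvectorUnitary
    have hd : Matrix.diagonal (fun i => lam1 A hA - hA.eigenvalues i) =
        lam1 A hA • (1 : Matrix (Fin n) (Fin n) ℝ) -
          Matrix.diagonal (RCLike.ofReal ∘ hA.eigenvalues) := by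
      ext i j
      by_cases hij : i = j <;> simp [Matrix.diagonal, hij]
    rw [hd, mul_sub, sub_mul, mul_smul_comm, mul_one, smul_mul_assoc, hU]
    congr 1
  rw [h1]
  refine Matrix.PosSemidef.mul_mul_conjTranspose_same ?_ _
  refine Matrix.PosSemidef.diagonal fun i => ?_
  exact sub_nonneg.2 (le_ciSup (Set.finite_range _).bddAbove i)

theorem dotProduct_mulVec_le_lam1 {n : ℕ} (A : Matrix (Fin n) (Fin n) ℝ) (hA : A.IsHermitian)
    (x : Fin n → ℝ) : x ⬝ᵥ A.mulVec x ≤ lam1 A hA * (x ⬝ᵥ x) := by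
  have h := (posSemidef_lam1_smul_one_sub A hA).dotProduct_mulVec_nonneg x
  simp only [Matrix.sub_mulVec, Matrix.smul_mulVec, Matrix.one_mulVec, dotProduct_sub,
    dotProduct_smul, star_trivial, smul_eq_mul] at h
  linarith

theorem mulVec_eq_of_lam1_le {n : ℕ} (A : Matrix (Fin n) (Fin n) ℝ) (hA : A.IsHermitian)
    (x : Fin n → ℝ) (h : lam1 A hA * (x ⬝ᵥ x) ≤ x ⬝ᵥ A.mulVec x) :
    A.mulVec x = lam1 A hA • x := by
  have hx := ((posSemidef_lam1_smul_one_sub A hA).dotProduct_mulVec_zero_iff x).1 (by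
    have := dotProduct_mulVec_le_lam1 A hA x
    simp only [Matrix.sub_mulVec, Matrix.smul_mulVec, Matrix.one_mulVec, dotProduct_sub,
      dotProduct_smul, star_trivial, smul_eq_mul]
    linarith)
  simp only [Matrix.sub_mulVec, Matrix.smul_mulVec, Matrix.one_mulVec] at hx
  exact (sub_eq_zero.1 hx).symm

theorem exists_mulVec_eq_lam1_smul {n : ℕ} (hn : 0 < n) (A : Matrix (Fin n) (Fin n) ℝ)
    (hA : A.IsHermitian) : ∃ x : Fin n → ℝ, x ≠ 0 ∧ A.mulVec x = lam1 A hA • x := by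
  have : Nonempty (Fin n) := ⟨⟨0, hn⟩⟩
  obtain ⟨i, hi⟩ := exists_eq_ciSup_of_finite (f := hA.eigenvalues)
  refine ⟨hA.eigenvectorBasis i, ?_, ?_⟩
  · have := hA.eigenvectorBasis.toBasis.ne_zero i
    intro h
    apply this
    ext j
    simpa using congrFun h j
  · rw [hA.mulVec_eigenvectorBasis, hi]
    rfl

/-- The signed clique on the complement of `{a, b}`, together with the triangle `a b c` whose only
negative edge is `a b`. -/
def cliqueWithTriangle {n : ℕ} (a b c i j : Fin n) : ℝ :=
  if i = j then 0
  else if (i = a ∧ j = b) ∨ (i = b ∧ j = a) then -1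
  else if ((i = a ∨ i = b) ∧ j = c) ∨ ((j = a ∨ j = b) ∧ i = c) then 1
  else if (i ≠ a ∧ i ≠ b) ∧ (j ≠ a ∧ j ≠ b) then 1
  else 0

theorem exists_equiv_gamma1 {n : ℕ} (hn : 3 ≤ n) {a b c : Fin n} (hab : a ≠ b) (hac : a ≠ c)
    (hbc : b ≠ c) :
    ∃ e : Fin n ≃ Fin n, ∀ i j, gamma1 n (e i) (e j) = cliqueWithTriangle a b c i j := by
  obtain ⟨e, ha, hb, hc⟩ : ∃ e : Fin n ≃ Fin n, e a = ⟨0, by omega⟩ ∧ e b = ⟨1, by omega⟩ ∧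
      e c = ⟨2, by omega⟩ := by
    obtain ⟨e₁, h₁⟩ : ∃ e : Fin n ≃ Fin n, e a = ⟨0, by omega⟩ :=
      ⟨Equiv.swap a ⟨0, by omega⟩, by simp⟩
    obtain ⟨e₂, h₂, h₃⟩ : ∃ e : Fin n ≃ Fin n, e a = ⟨0, by omega⟩ ∧ e b = ⟨1, by omega⟩ := by
      refine ⟨e₁.trans (Equiv.swap (e₁ b) ⟨1, by omega⟩), ?_, by simp⟩
      rw [Equiv.trans_apply, h₁]
      refine Equiv.swap_apply_of_ne_of_ne ?_ (by simp)
      rw [← h₁]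
      exact e₁.injective.ne hab
    refine ⟨e₂.trans (Equiv.swap (e₂ c) ⟨2, by omega⟩), ?_, ?_, by simp⟩
    · rw [Equiv.trans_apply, h₂]
      refine Equiv.swap_apply_of_ne_of_ne ?_ (by simp)
      rw [← h₂]
      exact e₂.injective.ne hac
    · rw [Equiv.trans_apply, h₃]
      refine Equiv.swap_apply_of_ne_of_ne ?_ (by simp)
      rw [← h₃]
      exact e₂.injective.ne hbc
  have va : ∀ i, (e i).val = 0 ↔ i = a := fun i => by
    rw [← e.injective.eq_iff, ha, Fin.ext_iff]
  have vb : ∀ i, (e i).val = 1 ↔ i = b := fun i => by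
    rw [← e.injective.eq_iff, hb, Fin.ext_iff]
  have vc : ∀ i, (e i).val = 2 ↔ i = c := fun i => by
    rw [← e.injective.eq_iff, hc, Fin.ext_iff]
  have v1 : ∀ i, (e i).val ≤ 1 ↔ (i = a ∨ i = b) := fun i => by
    rw [← va, ← vb]; omega
  have v2 : ∀ i, 2 ≤ (e i).val ↔ (i ≠ a ∧ i ≠ b) := fun i => by
    rw [Ne, Ne, ← va, ← vb]; omega
  refine ⟨e, fun i j => ?_⟩
  simp only [gamma1, cliqueWithTriangle, va, vb, vc, v1, v2, e.injective.eq_iff]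

theorem dotProduct_gamma1_comp {n : ℕ} {a b c : Fin n} {e : Fin n ≃ Fin n}
    (he : ∀ i j, gamma1 n (e i) (e j) = cliqueWithTriangle a b c i j) (x : Fin n → ℝ) :
    (x ∘ e.symm) ⬝ᵥ (gamma1 n).mulVec (x ∘ e.symm) =
      ∑ i, x i * ∑ j, cliqueWithTriangle a b c i j * x j := by
  simp only [dotProduct, Matrix.mulVec]
  rw [← e.sum_comp]
  refine Finset.sum_congr rfl fun i _ => ?_
  rw [← e.sum_comp]
  simp only [Function.comp_apply, Equiv.symm_apply_apply, he]

section RowSums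

variable {n : ℕ} {a b c : Fin n}

theorem sum_cliqueWithTriangle_left (hab : a ≠ b) (hac : a ≠ c) (hbc : b ≠ c) (x : Fin n → ℝ) :
    ∑ j, cliqueWithTriangle a b c a j * x j = x c - x b := by
  have h : ∀ j, cliqueWithTriangle a b c a j * x j =
      (if j = c then x j else 0) - (if j = b then x j else 0) := by
    intro j
    simp only [cliqueWithTriangle]
    grind
  simp [h]

theorem sum_cliqueWithTriangle_right (hab : a ≠ b) (hac : a ≠ c) (hbc : b ≠ c) (x : Fin n → ℝ) :
    ∑ j, cliqueWithTriangle a b c b j * x j = x c - x a := by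
  have h : ∀ j, cliqueWithTriangle a b c b j * x j =
      (if j = c then x j else 0) - (if j = a then x j else 0) := by
    intro j
    simp only [cliqueWithTriangle]
    grind
  simp [h]

theorem sum_cliqueWithTriangle_center (hac : a ≠ c) (hbc : b ≠ c) (x : Fin n → ℝ) :
    ∑ j, cliqueWithTriangle a b c c j * x j = ∑ j, x j - x c := by
  have h : ∀ j, cliqueWithTriangle a b c c j * x j = x j - (if j = c then x j else 0) := by
    intro j
    simp only [cliqueWithTriangle]
    grind
  simp [h]

theorem sum_cliqueWithTriangle_of_ne (hab : a ≠ b) {i : Fin n} (hia : i ≠ a) (hib : i ≠ b)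
    (hic : i ≠ c) (x : Fin n → ℝ) :
    ∑ j, cliqueWithTriangle a b c i j * x j = ∑ j, x j - x i - x a - x b := by
  have h : ∀ j, cliqueWithTriangle a b c i j * x j = x j - (if j = i then x j else 0) -
      (if j = a then x j else 0) - (if j = b then x j else 0) := by
    intro j
    simp only [cliqueWithTriangle]
    grind
  simp [h]

end RowSums

theorem lam1_gamma1_lower {n : ℕ} (hn : 5 ≤ n) (hG : (gamma1 n).IsHermitian) :
    ((n : ℝ) - 2) ^ 3 * (n - 3) + 4 * (n - 2) - 2 ≤
      lam1 (gamma1 n) hG * (((n : ℝ) - 2) ^ 3 + 2) := by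
  obtain ⟨a, b, c, hab, hac, hbc⟩ : ∃ a b c : Fin n, a ≠ b ∧ a ≠ c ∧ b ≠ c :=
    ⟨⟨0, by omega⟩, ⟨1, by omega⟩, ⟨2, by omega⟩, by simp, by simp, by simp⟩
  obtain ⟨e, he⟩ := exists_equiv_gamma1 (by omega) hab hac hbc
  obtain ⟨m, hm⟩ : ∃ m : ℝ, (n : ℝ) = m + 2 := ⟨n - 2, by ring⟩
  rw [hm]
  let y : Fin n → ℝ := fun i => if i = a ∨ i = b then 1 else m
  have hya : y a = 1 := by simp [y]
  have hyb : y b = 1 := by simp [y]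
  have hy : ∀ i, i ≠ a → i ≠ b → y i = m := by
    intro i h1 h2
    simp [y, h1, h2]
  clear_value y
  have key : ∀ f : Fin n → ℝ, ∀ u v : ℝ, f a = u → f b = u → f c = v → ∀ w : ℝ,
      (∀ i, i ≠ a → i ≠ b → i ≠ c → f i = w) → ∑ i, f i = (m - 1) * w + 2 * u + v := by
    intro f u v ha hb hc w hw
    have h : ∀ i, f i = w + (if i = a then u - w else 0) + (if i = b then u - w else 0) +
        (if i = c then v - w else 0) := by
      intro i
      by_cases h1 : i = a
      · subst h1; simp [hab, hac, ha]
      by_cases h2 : i = b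
      · subst h2; simp [hab.symm, hbc, hb]
      by_cases h3 : i = c
      · subst h3; simp [hac.symm, hbc.symm, hc]
      simp [h1, h2, h3, hw i h1 h2 h3]
    rw [Finset.sum_congr rfl fun i _ => h i]
    simp only [Finset.sum_add_distrib, Finset.sum_ite_eq', Finset.mem_univ, if_true,
      Finset.sum_const, Finset.card_univ, Fintype.card_fin, nsmul_eq_mul, hm]
    ring
  have hyc : y c = m := hy c hac.symm hbc.symm
  have hsum : ∑ i, y i = (m - 1) * m + 2 * 1 + m :=
    key y 1 m hya hyb hyc m fun i h1 h2 _ => hy i h1 h2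
  have h := dotProduct_mulVec_le_lam1 (gamma1 n) hG (y ∘ e.symm)
  rw [dotProduct_gamma1_comp he] at h
  have hyy : (y ∘ e.symm) ⬝ᵥ (y ∘ e.symm) = m ^ 3 + 2 := by
    have h1 : (y ∘ e.symm) ⬝ᵥ (y ∘ e.symm) = ∑ i, y i * y i := by
      simp only [dotProduct]
      rw [← e.sum_comp]
      simp
    rw [h1, key _ 1 (m * m) (by simp [hya]) (by simp [hyb]) (by simp [hyc]) (m * m)
      fun i h1 h2 _ => by rw [hy i h1 h2]]
    ring
  rw [hyy, key _ (m - 1) (m * (∑ i, y i - m))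
    (by rw [sum_cliqueWithTriangle_left hab hac hbc, hya, hyb, hyc, one_mul])
    (by rw [sum_cliqueWithTriangle_right hab hac hbc, hya, hyb, hyc, one_mul])
    (by rw [sum_cliqueWithTriangle_center hac hbc, hyc]) (m * (∑ i, y i - m - 1 - 1))
    (fun i h1 h2 h3 => by
      rw [sum_cliqueWithTriangle_of_ne hab h1 h2 h3, hy i h1 h2, hya, hyb]), hsum] at h
  ring_nf at h ⊢
  linarith

theorem lam1_gamma1_gt {n : ℕ} (hn : 5 ≤ n) (hG : (gamma1 n).IsHermitian) :
    (n : ℝ) - 3 < lam1 (gamma1 n) hG := by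
  have h := lam1_gamma1_lower hn hG
  have hn' : (5 : ℝ) ≤ n := by exact_mod_cast hn
  have h3 : 0 < ((n : ℝ) - 2) ^ 3 + 2 := by
    have : 0 < (n : ℝ) - 2 := by linarith
    positivity
  by_contra! hc
  nlinarith [mul_le_mul_of_nonneg_right hc h3.le]

theorem pos_of_cliqueWithTriangle_eigenvector {n : ℕ} {a b c : Fin n} (hab : a ≠ b) (hac : a ≠ c)
    (hbc : b ≠ c) {μ : ℝ} (hμ : 1 < μ) {x : Fin n → ℝ} (hx : ∀ i, 0 ≤ x i) (hx0 : x ≠ 0)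
    (h : ∀ i, ∑ j, cliqueWithTriangle a b c i j * x j = μ * x i) : ∀ i, 0 < x i := by
  have hc : 0 < x c := by
    refine (hx c).lt_of_ne fun h0 => hx0 ?_
    have hs := h c
    rw [← h0, mul_zero, Finset.sum_eq_zero_iff_of_nonneg] at hs
    · funext j
      by_cases hj : j = c
      · rw [hj, ← h0]; rfl
      · have := hs j (Finset.mem_univ j)
        have h1 : cliqueWithTriangle a b c c j = 1 := by
          simp only [cliqueWithTriangle]
          grind
        simpa [h1] using this
    · intro j _
      refine mul_nonneg ?_ (hx j)
      simp only [cliqueWithTriangle]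
      grind
  have ha : μ * x a = x c - x b := by
    rw [← h a, sum_cliqueWithTriangle_left hab hac hbc]
  have hb : μ * x b = x c - x a := by
    rw [← h b, sum_cliqueWithTriangle_right hab hac hbc]
  have hxab : x a = x b := by
    have : (μ - 1) * (x a - x b) = 0 := by linarith
    rcases mul_eq_zero.1 this with h | h <;> linarith
  have hapos : 0 < x a := by
    by_contra! hle
    have := le_antisymm hle (hx a)
    rw [← hxab, this] at ha
    linarith
  intro i
  by_cases hia : i = a
  · rwa [hia]
  by_cases hib : i = b
  · rwa [hib, ← hxab]
  by_cases hic : i = c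
  · rwa [hic]
  have hle : x c ≤ μ * x i := by
    rw [← h i]
    have h1 : cliqueWithTriangle a b c i c * x c = x c := by
      simp only [cliqueWithTriangle]
      grind
    rw [← h1]
    refine Finset.single_le_sum (f := fun j => cliqueWithTriangle a b c i j * x j) ?_
      (Finset.mem_univ c)
    intro j _
    refine mul_nonneg ?_ (hx j)
    simp only [cliqueWithTriangle]
    grind
  by_contra! hle'
  nlinarith

theorem eq_cliqueWithTriangle_of_le {n : ℕ} (hn : 5 ≤ n) (hG : (gamma1 n).IsHermitian)
    {a b c : Fin n} (hab : a ≠ b) (hac : a ≠ c) (hbc : b ≠ c) {B : Matrix (Fin n) (Fin n) ℝ}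
    (hB : ∀ i j, B i j ≤ cliqueWithTriangle a b c i j) {lam : ℝ}
    (hlam : lam1 (gamma1 n) hG ≤ lam) {x : Fin n → ℝ} (hx : ∀ i, 0 ≤ x i) (hx0 : x ≠ 0)
    (hBx : ∀ i, ∑ j, B i j * x j = lam * x i) :
    ∀ i j, B i j = cliqueWithTriangle a b c i j := by
  obtain ⟨e, he⟩ := exists_equiv_gamma1 (by omega) hab hac hbc
  have hle := dotProduct_mulVec_le_lam1 (gamma1 n) hG (x ∘ e.symm)
  have heq := mulVec_eq_of_lam1_le (gamma1 n) hG (x ∘ e.symm)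
  have hxx : (x ∘ e.symm) ⬝ᵥ (x ∘ e.symm) = ∑ i, x i * x i := by
    simp only [dotProduct]
    rw [← e.sum_comp]
    simp
  have hxx0 : 0 ≤ ∑ i, x i * x i := Finset.sum_nonneg fun i _ => mul_self_nonneg _
  have hquad : ∑ i, x i * ∑ j, B i j * x j = lam * ∑ i, x i * x i := by
    rw [Finset.mul_sum]
    refine Finset.sum_congr rfl fun i _ => ?_
    rw [hBx]; ring
  have hcmp : ∀ i, x i * ∑ j, B i j * x j ≤ x i * ∑ j, cliqueWithTriangle a b c i j * x j :=
    fun i => mul_le_mul_of_nonneg_left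
      (Finset.sum_le_sum fun j _ => mul_le_mul_of_nonneg_right (hB i j) (hx j)) (hx i)
  have hsum := Finset.sum_le_sum fun i (_ : i ∈ Finset.univ) => hcmp i
  rw [dotProduct_gamma1_comp he, hxx] at hle heq
  have hmul := mul_le_mul_of_nonneg_right hlam hxx0
  have hev := heq (by linarith)
  have hpos : ∀ i, 0 < x i := by
    refine pos_of_cliqueWithTriangle_eigenvector hab hac hbc (μ := lam1 (gamma1 n) hG) ?_ hx hx0 ?_
    · have := lam1_gamma1_gt hn hG
      have hn' : (5 : ℝ) ≤ n := by exact_mod_cast hn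
      linarith
    · intro i
      have := congrFun hev (e i)
      simp only [Matrix.mulVec, dotProduct, Pi.smul_apply, Function.comp_apply,
        Equiv.symm_apply_apply, smul_eq_mul] at this
      rw [← this, ← e.sum_comp fun j => gamma1 n (e i) j * x (e.symm j)]
      exact Finset.sum_congr rfl fun j _ => by rw [he, Equiv.symm_apply_apply]
  have hsumeq : ∑ i, x i * ∑ j, B i j * x j =
      ∑ i, x i * ∑ j, cliqueWithTriangle a b c i j * x j := by linarith
  intro i j
  have h1 := (Finset.sum_eq_sum_iff_of_le fun i _ => hcmp i).1 hsumeq i (Finset.mem_univ i)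
  have h2 := mul_left_cancel₀ (hpos i).ne' h1
  have h3 := (Finset.sum_eq_sum_iff_of_le fun j _ =>
    mul_le_mul_of_nonneg_right (hB i j) (hx j)).1 h2 j (Finset.mem_univ j)
  exact mul_right_cancel₀ (hpos j).ne' h3

/-- `B` is the adjacency matrix of a signed graph without negative 4-cycles. -/
structure IsNegC4Free {n : ℕ} (B : Matrix (Fin n) (Fin n) ℝ) : Prop where
  symm : ∀ i j, B i j = B j i
  val : ∀ i j, B i j = 0 ∨ B i j = 1 ∨ B i j = -1
  diag : ∀ i, B i i = 0
  prod_ne : ∀ a b c d, a ≠ c → b ≠ d → B a b * B b c * B c d * B d a ≠ -1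

namespace IsNegC4Free

variable {n : ℕ} {B : Matrix (Fin n) (Fin n) ℝ}

theorem ne_of_entry_ne_zero (hB : IsNegC4Free B) {i j : Fin n} (h : B i j ≠ 0) : i ≠ j := by
  rintro rfl
  exact h (hB.diag i)

/-- If `v` and `w` are joined positively to `r` and `u v` is a negative edge with `u ≠ r`, then
`u w` is not a positive edge. -/
theorem nonpos_of_neg (hB : IsNegC4Free B) {r u v w : Fin n} (hur : u ≠ r) (huv : B u v = -1)
    (hrv : B r v = 1) (hrw : B r w = 1) : B u w ≤ 0 := by
  rcases hB.val u w with h | h | h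
  · rw [h]
  · exfalso
    have hvw : w ≠ v := by
      rintro rfl
      linarith
    apply hB.prod_ne r w u v hur.symm hvw
    rw [hB.symm w u, hB.symm v r, hrw, h, huv, hrv]
    norm_num
  · rw [h]; norm_num

theorem le_cliqueWithTriangle (hB : IsNegC4Free B) {r u v : Fin n} (hr : ∀ j, j ≠ r → B r j = 1)
    (huv : B u v = -1) (hur : u ≠ r) (hvr : v ≠ r) (i j : Fin n) :
    B i j ≤ cliqueWithTriangle u v r i j := by
  have hle : ∀ i j, B i j ≤ 1 := fun i j => by
    rcases hB.val i j with h | h | h <;> rw [h] <;> norm_num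
  have hu : ∀ w, w ≠ r → B u w ≤ 0 := fun w hw => hB.nonpos_of_neg hur huv (hr v hvr) (hr w hw)
  have hv : ∀ w, w ≠ r → B v w ≤ 0 := fun w hw =>
    hB.nonpos_of_neg hvr (by rw [hB.symm, huv]) (hr u hur) (hr w hw)
  have h1 := hle i j
  have h2 := hB.diag i
  have h3 := hB.symm i j
  have h4 := hB.symm u v
  have h5 := hu i
  have h6 := hv i
  have h7 := hu j
  have h8 := hv j
  simp only [cliqueWithTriangle]
  grind

/-- If `r` has maximal weight and is joined positively to all vertices but `z`, then the positive
neighbours of `r` span no negative edge. -/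
theorem false_of_neg_edge (hB : IsNegC4Free B) (hn : 5 ≤ n) {lam : ℝ} (hlam : (n : ℝ) - 3 < lam)
    (hlam5 : n = 5 → 2.2 ≤ lam) {x : Fin n → ℝ} (hx : ∀ i, 0 ≤ x i)
    (hBx : ∀ i, ∑ j, B i j * x j = lam * x i) {r z u v : Fin n} (hxr : 0 < x r)
    (hmax : ∀ j, x j ≤ x r) (hzr : z ≠ r) (hrz : B r z ≤ 0)
    (hr : ∀ j, j ≠ r → j ≠ z → B r j = 1) (hur : u ≠ r) (huz : u ≠ z) (hvr : v ≠ r) (hvz : v ≠ z)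
    (huv : B u v = -1) : False := by
  have hn' : (5 : ℝ) ≤ n := by exact_mod_cast hn
  have hne : u ≠ v := hB.ne_of_entry_ne_zero (by rw [huv]; norm_num)
  have hvu : B v u = -1 := by rw [hB.symm, huv]
  have hrr := hB.diag r
  have hu : ∀ w, w ≠ r → w ≠ z → B u w ≤ 0 := fun w h1 h2 =>
    hB.nonpos_of_neg hur huv (hr v hvr hvz) (hr w h1 h2)
  have hv : ∀ w, w ≠ r → w ≠ z → B v w ≤ 0 := fun w h1 h2 =>
    hB.nonpos_of_neg hvr hvu (hr u hur huz) (hr w h1 h2)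
  have hR : lam * x r ≤ (n - 4) * x r + x u + x v := by
    rw [← hBx r]
    have : ∀ j, B r j * x j ≤ x r + (if j = r then - x r else 0) + (if j = z then - x r else 0) +
        (if j = u then x u - x r else 0) + (if j = v then x v - x r else 0) := by
      intro j
      have h1 := hx j
      have h2 := hmax j
      have h3 := hr j
      rcases hB.val r j with h | h | h <;> rw [h] <;> grind
    refine (Finset.sum_le_sum fun j _ => this j).trans (le_of_eq ?_)
    simp [Finset.sum_add_distrib]
    ring
  have hrow : ∀ u v, v ≠ r → v ≠ z → B u v = -1 → (∀ w, w ≠ r → w ≠ z → B u w ≤ 0) →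
      lam * x u ≤ x r - x v + B u z * x z := by
    intro u v hvr hvz huv hu
    rw [← hBx u]
    have : ∀ j, B u j * x j ≤ (if j = r then x r else 0) + (if j = v then - x v else 0) +
        (if j = z then B u z * x z else 0) := by
      intro j
      have h1 := hx j
      have h3 := hu j
      by_cases hjz : j = z
      · subst hjz
        simp [hzr, hvz.symm]
      · rcases hB.val u j with h | h | h <;> rw [h] <;> grind
    refine (Finset.sum_le_sum fun j _ => this j).trans (le_of_eq ?_)
    simp [Finset.sum_add_distrib]
    ring
  have hU := hrow u v hvr hvz huv hu
  have hV := hrow v u hur huz hvu hv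
  have hxz := hx z
  have hxzr := hmax z
  have hle : ∀ i j, B i j * x j ≤ x j := fun i j => by
    have := hx j
    rcases hB.val i j with h | h | h <;> rw [h] <;> linarith
  have hUz := hle u z
  have hVz := hle v z
  have hsum4 : (lam + 1) * (x u + x v) ≤ 4 * x r := by linarith
  by_cases h5 : n = 5
  · have hl := hlam5 h5
    obtain ⟨w, hwr, hwz, hwu, hwv⟩ : ∃ w : Fin n, w ≠ r ∧ w ≠ z ∧ w ≠ u ∧ w ≠ v := by
      have hcard : ({r, z, u, v} : Finset (Fin n)).card < (Finset.univ : Finset (Fin n)).card := by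
        refine (Finset.card_le_four).trans_lt ?_
        simp [h5]
      obtain ⟨w, _, hw⟩ := Finset.exists_mem_notMem_of_card_lt_card hcard
      exact ⟨w, by simpa using hw⟩
    have huniv : ∀ j : Fin n, j = r ∨ j = z ∨ j = u ∨ j = v ∨ j = w := by
      have hcard : ({r, z, u, v, w} : Finset (Fin n)).card = 5 := by
        rw [Finset.card_insert_of_notMem, Finset.card_insert_of_notMem,
          Finset.card_insert_of_notMem, Finset.card_insert_of_notMem, Finset.card_singleton] <;>
          simp_all [eq_comm]
      have huniv := (Finset.card_eq_iff_eq_univ _).1 (hcard.trans (by simp [h5]))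
      intro j
      have := Finset.mem_univ j
      rw [← huniv] at this
      simpa using this
    have hwu' : B w u ≤ 0 := by rw [hB.symm]; exact hu w hwr hwz
    have hwv' : B w v ≤ 0 := by rw [hB.symm]; exact hv w hwr hwz
    have hww := hB.diag w
    have hW : lam * x w ≤ x r + x z := by
      rw [← hBx w]
      have : ∀ j, B w j * x j ≤ (if j = r then x r else 0) + (if j = z then x z else 0) := by
        intro j
        have h1 := hx j
        have h3 := huniv j
        rcases hB.val w j with h | h | h <;> rw [h] <;> grind
      refine (Finset.sum_le_sum fun j _ => this j).trans (le_of_eq ?_)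
      simp [Finset.sum_add_distrib]
    have hR' : lam * x r ≤ x u + x v + x w := by
      rw [← hBx r]
      have : ∀ j, B r j * x j ≤ (if j = u then x u else 0) + (if j = v then x v else 0) +
          (if j = w then x w else 0) := by
        intro j
        have h1 := hx j
        have h3 := huniv j
        rcases hB.val r j with h | h | h <;> rw [h] <;> grind
      refine (Finset.sum_le_sum fun j _ => this j).trans (le_of_eq ?_)
      simp [Finset.sum_add_distrib]
    have hW2 : lam * x w ≤ 2 * x r := by linarith
    have e1 : lam * (lam + 1) * (lam * x r) ≤ lam * (4 * x r) + (lam + 1) * (2 * x r) := by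
      have e2 := mul_le_mul_of_nonneg_left hR' (show 0 ≤ lam * (lam + 1) by nlinarith)
      have e3 := mul_le_mul_of_nonneg_left hsum4 (show 0 ≤ lam by linarith)
      have e4 := mul_le_mul_of_nonneg_left hW2 (show 0 ≤ lam + 1 by linarith)
      linarith
    have e5 : (lam ^ 3 + lam ^ 2 - 6 * lam - 2) * x r ≤ 0 := by linarith
    have e6 : 0 < lam ^ 3 + lam ^ 2 - 6 * lam - 2 := by
      obtain ⟨d, rfl⟩ : ∃ d, lam = 2.2 + d := ⟨lam - 2.2, by ring⟩
      have hd : 0 ≤ d := by linarith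
      have : (2.2 + d) ^ 3 + (2.2 + d) ^ 2 - 6 * (2.2 + d) - 2 =
          0.288 + 12.92 * d + 7.6 * d ^ 2 + d ^ 3 := by ring
      rw [this]
      positivity
    nlinarith [mul_pos e6 hxr]
  · have hn6 : (6 : ℝ) ≤ n := by exact_mod_cast (by omega : 6 ≤ n)
    have e1 : (lam - (n - 4)) * x r ≤ x u + x v := by linarith
    have e2 := mul_le_mul_of_nonneg_left e1 (show 0 ≤ lam + 1 by linarith)
    have e3 : ((lam + 1) * (lam - (n - 4)) - 4) * x r ≤ 0 := by linarith
    have e4 : 0 < (lam + 1) * (lam - (n - 4)) - 4 := by nlinarith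
    nlinarith [mul_pos e4 hxr]

/-- If `r` has maximal weight and is joined positively to all vertices but `z`, then not all
negative edges are incident to `z`. -/
theorem false_of_nonneg_off (hB : IsNegC4Free B) (hn : 5 ≤ n) {lam : ℝ}
    (hlam : (n : ℝ) - 3 < lam) {x : Fin n → ℝ} (hx : ∀ i, 0 ≤ x i)
    (hBx : ∀ i, ∑ j, B i j * x j = lam * x i) {r z : Fin n} (hxr : 0 < x r)
    (hmax : ∀ j, x j ≤ x r) (hzr : z ≠ r) (hrz : B r z ≤ 0)
    (hr : ∀ j, j ≠ r → j ≠ z → B r j = 1) (hoff : ∀ i j, i ≠ z → j ≠ z → 0 ≤ B i j)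
    (hunbal : ∀ t : Fin n → ℝ, (∀ i, t i = 1 ∨ t i = -1) → ∃ i j, t i * B i j * t j < 0) :
    False := by
  have hn' : (5 : ℝ) ≤ n := by exact_mod_cast hn
  have hzz := hB.diag z
  obtain ⟨q, hq⟩ : ∃ q, B z q = -1 := by
    obtain ⟨i, j, hij⟩ := hunbal (fun _ => 1) fun _ => Or.inl rfl
    have hneg : B i j = -1 := by
      rcases hB.val i j with h | h | h <;> rw [h] at hij ⊢ <;> norm_num at hij
    by_cases hi : i = z
    · exact ⟨j, hi ▸ hneg⟩
    by_cases hj : j = z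
    · exact ⟨i, by rw [hB.symm, ← hj, hneg]⟩
    · linarith [hoff i j hi hj]
  obtain ⟨p, hp⟩ : ∃ p, B z p = 1 := by
    obtain ⟨i, j, hij⟩ := hunbal (fun k => if k = z then -1 else 1) fun k => by
      by_cases hk : k = z <;> simp [hk]
    by_cases hi : i = z <;> by_cases hj : j = z
    · simp [hi, hj, hzz] at hij
    · refine ⟨j, ?_⟩
      rcases hB.val z j with h | h | h <;> simp [hi, hj, h] at hij ⊢
      linarith
    · refine ⟨i, ?_⟩
      rw [hB.symm]
      rcases hB.val i z with h | h | h <;> simp [hi, hj, h] at hij ⊢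
      linarith
    · have := hoff i j hi hj
      simp [hi, hj] at hij
      linarith
  have hpz : p ≠ z := (hB.ne_of_entry_ne_zero (by rw [hp]; norm_num)).symm
  have hqz : q ≠ z := (hB.ne_of_entry_ne_zero (by rw [hq]; norm_num)).symm
  have hpr : p ≠ r := by
    rintro rfl
    rw [hB.symm, hp] at hrz
    linarith
  have hpq : p ≠ q := by
    rintro rfl
    linarith
  rcases hB.val r z with h0 | h0 | h0
  · have hqr : q ≠ r := by
      rintro rfl
      rw [hB.symm] at hq
      linarith
    apply hB.prod_ne z p r q hzr hpq
    rw [hp, hB.symm p r, hr p hpr hpz, hr q hqr hqz, hB.symm q z, hq]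
    norm_num
  · linarith
  have hiso : ∀ p, B z p = 1 → lam * x p ≤ x r + x z := by
    intro p hp
    have hpz : p ≠ z := (hB.ne_of_entry_ne_zero (by rw [hp]; norm_num)).symm
    rw [← hBx p]
    have : ∀ j, B p j * x j ≤ (if j = r then x r else 0) + (if j = z then x z else 0) := by
      intro j
      have h1 := hx j
      by_cases hj : j = r ∨ j = z
      · rcases hB.val p j with h | h | h <;> rw [h] <;> grind
      · obtain ⟨hjr, hjz⟩ := not_or.1 hj
        have h2 := hB.prod_ne z p j r (Ne.symm hjz) (by
          rintro rfl
          rw [hB.symm, hp] at hrz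
          linarith)
        rw [hp, hB.symm j r, hr j hjr hjz, h0] at h2
        have h3 := hoff p j hpz hjz
        rcases hB.val p j with h | h | h <;> rw [h] at h2 h3 ⊢
        · simp [hjr, hjz]
        · norm_num at h2
        · linarith
    refine (Finset.sum_le_sum fun j _ => this j).trans (le_of_eq ?_)
    simp [Finset.sum_add_distrib]
  have hxz := hx z
  have hxzr := hmax z
  have hP := hiso p hp
  have hrr := hB.diag r
  by_cases hk : ∃ p', p' ≠ p ∧ B z p' = 1
  · obtain ⟨p', hpp, hp'⟩ := hk
    have hP' := hiso p' hp'
    have hpz' : p' ≠ z := (hB.ne_of_entry_ne_zero (by rw [hp']; norm_num)).symm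
    have hR : lam * x r ≤ (n - 4) * x r + x p + x p' - x z := by
      rw [← hBx r]
      have : ∀ j, B r j * x j ≤ x r + (if j = r then - x r else 0) +
          (if j = z then - x r - x z else 0) +
          (if j = p then x p - x r else 0) + (if j = p' then x p' - x r else 0) := by
        intro j
        have h1 := hx j
        have h2 := hmax j
        have h3 := hr j
        rcases hB.val r j with h | h | h <;> rw [h] <;> grind
      refine (Finset.sum_le_sum fun j _ => this j).trans (le_of_eq ?_)
      simp [Finset.sum_add_distrib]
      ring
    have e1 : lam * (lam * x r) ≤ lam * ((n - 4) * x r + x p + x p' - x z) :=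
      mul_le_mul_of_nonneg_left hR (by linarith)
    have e2 : 0 ≤ (lam - 2) * x z := mul_nonneg (by linarith) hxz
    have e3 : (lam * (lam - (n - 4)) - 2) * x r ≤ 0 := by linarith
    have e4 : 0 < lam * (lam - (n - 4)) - 2 := by nlinarith
    nlinarith [mul_pos e4 hxr]
  · have hZ : lam * x z ≤ x p - x r := by
      rw [← hBx z]
      have : ∀ j, B z j * x j ≤ (if j = p then x p else 0) + (if j = r then - x r else 0) := by
        intro j
        have h1 := hx j
        have h2 := hB.symm r z
        have h3 : j ≠ p → B z j ≠ 1 := fun h h' => hk ⟨j, h, h'⟩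
        rcases hB.val z j with h | h | h <;> rw [h] <;> grind
      refine (Finset.sum_le_sum fun j _ => this j).trans (le_of_eq ?_)
      simp [Finset.sum_add_distrib, sub_eq_add_neg]
    nlinarith [mul_nonneg (show 0 ≤ lam by linarith) hxz]

theorem exists_eq_cliqueWithTriangle (hB : IsNegC4Free B) (hn : 5 ≤ n)
    (hG : (gamma1 n).IsHermitian) {lam : ℝ} (hlam : lam1 (gamma1 n) hG ≤ lam) {x : Fin n → ℝ}
    (hx : ∀ i, 0 ≤ x i) (hx0 : x ≠ 0) (hBx : ∀ i, ∑ j, B i j * x j = lam * x i)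
    (hunbal : ∀ t : Fin n → ℝ, (∀ i, t i = 1 ∨ t i = -1) → ∃ i j, t i * B i j * t j < 0) :
    ∃ a b c : Fin n, a ≠ b ∧ a ≠ c ∧ b ≠ c ∧ ∀ i j, B i j = cliqueWithTriangle a b c i j := by
  have hlam3 : (n : ℝ) - 3 < lam := (lam1_gamma1_gt hn hG).trans_le hlam
  have hlam5 : n = 5 → 2.2 ≤ lam := by
    rintro rfl
    have := lam1_gamma1_lower hn hG
    norm_num at this
    linarith
  have : Nonempty (Fin n) := ⟨⟨0, by omega⟩⟩
  obtain ⟨r, hmax⟩ := Finite.exists_max x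
  have hxr : 0 < x r := by
    by_contra! h
    exact hx0 (funext fun j => le_antisymm ((hmax j).trans h) (hx j))
  obtain ⟨u, v, huv⟩ : ∃ u v, B u v = -1 := by
    obtain ⟨i, j, hij⟩ := hunbal (fun _ => 1) fun _ => Or.inl rfl
    refine ⟨i, j, ?_⟩
    rcases hB.val i j with h | h | h <;> rw [h] at hij <;> norm_num at hij
    exact h
  have hone : ∀ j, ¬ B r j ≤ 0 → B r j = 1 := fun j h => by
    rcases hB.val r j with h' | h' | h' <;> rw [h'] at h ⊢ <;> norm_num at h
  by_cases hall : ∀ j, j ≠ r → B r j = 1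
  · have hur : u ≠ r := by
      rintro rfl
      have := hall v (hB.ne_of_entry_ne_zero (by rw [huv]; norm_num)).symm
      linarith
    have hvr : v ≠ r := by
      rintro rfl
      have := hall u (hB.ne_of_entry_ne_zero (by rw [huv]; norm_num))
      rw [hB.symm] at this
      linarith
    have hne : u ≠ v := hB.ne_of_entry_ne_zero (by rw [huv]; norm_num)
    exact ⟨u, v, r, hne, hur, hvr, eq_cliqueWithTriangle_of_le hn hG hne hur hvr
      (hB.le_cliqueWithTriangle hall huv hur hvr) hlam hx hx0 hBx⟩
  exfalso
  push Not at hall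
  obtain ⟨z, hzr, hz⟩ := hall
  have hrz : B r z ≤ 0 := by
    by_contra h
    exact hz (hone z h)
  have hr : ∀ j, j ≠ r → j ≠ z → B r j = 1 := by
    intro w hwr hwz
    refine hone w fun hw => ?_
    have hR : lam * x r ≤ (n - 3) * x r := by
      rw [← hBx r]
      have hrr := hB.diag r
      have : ∀ j, B r j * x j ≤ x r + (if j = r then - x r else 0) +
          (if j = z then - x r else 0) + (if j = w then - x r else 0) := by
        intro j
        have h1 := hx j
        have h2 := hmax j
        rcases hB.val r j with h | h | h <;> rw [h] <;> grind
      refine (Finset.sum_le_sum fun j _ => this j).trans (le_of_eq ?_)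
      simp [Finset.sum_add_distrib]
      ring
    exact absurd (le_of_mul_le_mul_right hR hxr) hlam3.not_ge
  refine hB.false_of_nonneg_off hn hlam3 hx hBx hxr hmax hzr hrz hr ?_ hunbal
  intro i j hi hj
  by_contra! hneg
  have hij : B i j = -1 := by
    rcases hB.val i j with h | h | h <;> rw [h] at hneg ⊢ <;> norm_num at hneg
  have hne : i ≠ j := hB.ne_of_entry_ne_zero hneg.ne
  have hir : i ≠ r := by
    rintro rfl
    linarith [hr j hne.symm hj]
  have hjr : j ≠ r := by
    rintro rfl
    rw [hB.symm] at hij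
    linarith [hr i hne hi]
  exact hB.false_of_neg_edge hn hlam3 hlam5 hx hBx hxr hmax hzr hrz hr hir hi hjr hj hij

end IsNegC4Free

/-- In a signed graph that can be switched to an all-positive one, the sign of a walk only depends
on its end points. -/
theorem walkSign_eq_of_balanced {V : Type*} {G : SimpleGraph V} {σ : V → V → ℝ} {s : V → ℝ}
    (hs : ∀ v, s v = 1 ∨ s v = -1) (hσ : ∀ i j, G.Adj i j → σ i j = s i * s j) {u v : V}
    (p : G.Walk u v) : walkSign σ p = s u * s v := by
  have hsq : ∀ v, s v * s v = 1 := fun v => by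
    rcases hs v with h | h <;> rw [h] <;> norm_num
  induction p with
  | nil => simp [walkSign, hsq]
  | @cons a b c h p ih =>
    have : walkSign σ (SimpleGraph.Walk.cons h p) = σ a b * walkSign σ p := by
      simp [walkSign]
    rw [this, ih, hσ _ _ h]
    linear_combination s a * s c * hsq b

theorem exists_four_cycle_walkSign {V : Type*} {G : SimpleGraph V} (σ : V → V → ℝ) {a b c d : V}
    (hab : G.Adj a b) (hbc : G.Adj b c) (hcd : G.Adj c d) (hda : G.Adj d a) (hac : a ≠ c)
    (hbd : b ≠ d) :
    ∃ p : G.Walk a a, p.IsCycle ∧ p.length = 4 ∧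
      walkSign σ p = σ a b * σ b c * σ c d * σ d a := by
  refine ⟨.cons hab (.cons hbc (.cons hcd (.cons hda .nil))), ?_, by simp, ?_⟩
  · have h1 := hab.ne
    have h2 := hbc.ne
    have h3 := hcd.ne
    have h4 := hda.ne
    rw [SimpleGraph.Walk.cons_isCycle_iff]
    simp only [SimpleGraph.Walk.cons_isPath_iff, SimpleGraph.Walk.support_cons,
      SimpleGraph.Walk.support_nil, SimpleGraph.Walk.edges_cons, SimpleGraph.Walk.edges_nil,
      List.mem_cons, Sym2.eq_iff]
    simp
    grind
  · simp [walkSign]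
    ring

/-- Let `Γ` be an unbalanced signed graph of order `n ≥ 5`. If `λ₁(Γ) ≥ λ₁(Γ₁)`, then `Γ`
contains a negative 4-cycle, unless `Γ` is switching equivalent (up to isomorphism) to `Γ₁`. -/
theorem stmt13 {n : ℕ} (hn : 5 ≤ n) (G : SimpleGraph (Fin n)) [DecidableRel G.Adj]
    (σ : Fin n → Fin n → ℝ)
    (hsym : ∀ i j, σ i j = σ j i)
    (hval : ∀ i j, G.Adj i j → σ i j = 1 ∨ σ i j = -1)
    (A : Matrix (Fin n) (Fin n) ℝ)
    (hAdef : A = fun i j => if G.Adj i j then σ i j else 0)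
    (hA : A.IsHermitian) (hG1 : (gamma1 n).IsHermitian)
    (hunbal : ∃ (v : Fin n) (p : G.Walk v v), p.IsCycle ∧ walkSign σ p = -1)
    (hlam : lam1 (gamma1 n) hG1 ≤ lam1 A hA) :
    (∃ (v : Fin n) (p : G.Walk v v), p.IsCycle ∧ p.length = 4 ∧ walkSign σ p = -1) ∨
    (∃ (e : Fin n ≃ Fin n) (sw : Fin n → ℝ), (∀ v, sw v = 1 ∨ sw v = -1) ∧
      ∀ i j, A i j = sw i * gamma1 n (e i) (e j) * sw j) := by
  obtain ⟨x, hx0, hAx⟩ := exists_mulVec_eq_lam1_smul (by omega) A hA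
  obtain ⟨s, hs, hsx⟩ : ∃ s : Fin n → ℝ, (∀ v, s v = 1 ∨ s v = -1) ∧ ∀ v, s v * x v = |x v| := by
    refine ⟨fun v => if 0 ≤ x v then 1 else -1, fun v => ?_, fun v => ?_⟩
    · by_cases h : 0 ≤ x v <;> simp [h]
    · by_cases h : 0 ≤ x v
      · simp [h, abs_of_nonneg]
      · simp [h, abs_of_neg (not_le.1 h)]
  have hsq : ∀ v, s v * s v = 1 := fun v => by
    rcases hs v with h | h <;> rw [h] <;> norm_num
  have hval' : ∀ i j, A i j = 0 ∨ A i j = 1 ∨ A i j = -1 := by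
    intro i j
    by_cases h : G.Adj i j
    · simpa [hAdef, h] using Or.inr (hval i j h)
    · simp [hAdef, h]
  rw [or_iff_not_imp_left]
  intro hno
  let B : Matrix (Fin n) (Fin n) ℝ := fun i j => s i * A i j * s j
  have hB : IsNegC4Free B := by
    refine ⟨fun i j => ?_, fun i j => ?_, fun i => by simp [B, hAdef], fun a b c d hac hbd h => ?_⟩
    · have : A i j = A j i := by simp only [hAdef, G.adj_comm i j, hsym i j]
      simp only [B, this]
      ring
    · rcases hval' i j with h | h | h <;> rcases hs i with h1 | h1 <;> rcases hs j with h2 | h2 <;>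
        simp [B, h, h1, h2]
    · have hprod : A a b * A b c * A c d * A d a = -1 := by
        rw [← h]
        simp only [B]
        linear_combination (- A a b * A b c * A c d * A d a) *
          (hsq a + s a * s a * (hsq b + s b * s b * (hsq c + s c * s c * hsq d)))
      have hadj : ∀ i j, A i j ≠ 0 → G.Adj i j := by
        intro i j hne
        by_contra hG
        simp [hAdef, hG] at hne
      have hab := hadj a b fun h0 => by simp [h0] at hprod
      have hbc := hadj b c fun h0 => by simp [h0] at hprod
      have hcd := hadj c d fun h0 => by simp [h0] at hprod
      have hda := hadj d a fun h0 => by simp [h0] at hprod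
      obtain ⟨p, hp, hl, hsign⟩ := exists_four_cycle_walkSign σ hab hbc hcd hda hac hbd
      refine hno ⟨a, p, hp, hl, ?_⟩
      rw [hsign, ← hprod]
      simp [hAdef, hab, hbc, hcd, hda]
  have hunbal' : ∀ t : Fin n → ℝ, (∀ i, t i = 1 ∨ t i = -1) →
      ∃ i j, t i * B i j * t j < 0 := by
    intro t ht
    by_contra! hc
    obtain ⟨v, p, -, hp⟩ := hunbal
    have hts : ∀ v, t v * s v = 1 ∨ t v * s v = -1 := fun v => by
      rcases ht v with h1 | h1 <;> rcases hs v with h2 | h2 <;> simp [h1, h2]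
    have hbal := walkSign_eq_of_balanced (σ := σ) hts (fun i j hij => by
      have h := hc i j
      have hA' : A i j = σ i j := by simp [hAdef, hij]
      have h' : 0 ≤ (t i * s i) * σ i j * (t j * s j) := by
        simp only [B, hA'] at h
        linarith
      rcases hval i j hij with h0 | h0 <;> rcases hts i with h1 | h1 <;>
        rcases hts j with h2 | h2 <;> rw [h0, h1, h2] at h' ⊢ <;>
        linarith) p
    rw [hp] at hbal
    linarith [mul_self_nonneg (t v * s v)]
  have hBx : ∀ i, ∑ j, B i j * |x j| = lam1 A hA * |x i| := by
    intro i
    have h := congrFun hAx i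
    simp only [Matrix.mulVec, dotProduct, Pi.smul_apply, smul_eq_mul] at h
    rw [← hsx i, mul_left_comm, ← h, Finset.mul_sum]
    refine Finset.sum_congr rfl fun j _ => ?_
    rw [← hsx j]
    simp only [B]
    linear_combination s i * A i j * x j * hsq j
  obtain ⟨a, b, c, hab, hac, hbc, h⟩ := hB.exists_eq_cliqueWithTriangle hn hG1 hlam
    (x := fun i => |x i|) (fun i => abs_nonneg _)
    (fun h => hx0 (funext fun i => abs_eq_zero.1 (congrFun h i))) hBx hunbal'
  obtain ⟨e, he⟩ := exists_equiv_gamma1 (by omega) hab hac hbc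
  refine ⟨e, s, hs, fun i j => ?_⟩
  rw [he, ← h]
  simp only [B]
  linear_combination (- A i j) * (hsq i + s i * s i * hsq j)
end

section
/- Let Γ be an unbalanced signed graph of order n ≥ 12. If λ₁(Γ) ≥ λ₁(Γ₁), where Γ₁ = C₃⁻ • K_{n−2}, then Γ contains a negative 5-cycle, unless Γ is switching equivalent to Γ₁. -/
/-- `y` is a nonnegative eigenvector, with maximum entry `y m = 1`, of the signed adjacency
matrix `B`, for an eigenvalue `lam` exceeding the order of the graph minus three. -/
structure IsDominantVector {V : Type*} [Fintype V] (B : V → V → ℝ) (y : V → ℝ) (lam : ℝ)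
    (m : V) : Prop where
  symm : ∀ i j, B i j = B j i
  diag : ∀ i, B i i = 0
  entry : ∀ i j, B i j = 0 ∨ B i j = 1 ∨ B i j = -1
  nonneg : ∀ i, 0 ≤ y i
  le_one : ∀ i, y i ≤ 1
  max : y m = 1
  eigen : ∀ i, lam * y i = ∑ j, B i j * y j
  nine_le : 9 ≤ lam
  card_lt : (Fintype.card V : ℝ) - 3 < lam

/-- No path of length four with positive edges joins `u` and `w`. -/
def NoPosPath {V : Type*} (B : V → V → ℝ) (u w : V) : Prop :=
  ∀ a b c, b ≠ u → b ≠ w → a ≠ c → B u a = 1 → B a b = 1 → B b c = 1 → B c w = 1 → False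

lemma NoPosPath.symm {V : Type*} {B : V → V → ℝ} (hs : ∀ i j, B i j = B j i) {u w : V}
    (hP : NoPosPath B u w) : NoPosPath B w u :=
  fun a b c h1 h2 h3 h4 h5 h6 h7 => hP c b a h2 h1 h3.symm (by rw [hs, h7]) (by rw [hs, h6])
    (by rw [hs, h5]) (by rw [hs, h4])

namespace IsDominantVector

variable {V : Type*} [Fintype V] {B : V → V → ℝ} {y : V → ℝ} {lam : ℝ} {m : V}

lemma mul_le (h : IsDominantVector B y lam m) (i j : V) : B i j * y j ≤ y j := by
  have := h.nonneg j
  rcases h.entry i j with e | e | e <;> rw [e] <;> linarith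

lemma mul_le_zero (h : IsDominantVector B y lam m) {i j : V} (hij : B i j ≠ 1) :
    B i j * y j ≤ 0 := by
  have := h.nonneg j
  rcases h.entry i j with e | e | e
  · simp [e]
  · exact absurd e hij
  · rw [e]; linarith

lemma ne_of_pos (h : IsDominantVector B y lam m) {i j : V} (hij : B i j = 1) : i ≠ j := by
  rintro rfl
  simp [h.diag] at hij

/-- The total deficiency of the row of the maximum entry is less than three. -/
lemma deficiency_lt (h : IsDominantVector B y lam m) (K : Finset V) :
    ∑ j ∈ K, (1 - B m j * y j) < 3 := by
  have h1 : ∑ j ∈ K, (1 - B m j * y j) ≤ ∑ j, (1 - B m j * y j) :=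
    Finset.sum_le_sum_of_subset_of_nonneg (Finset.subset_univ _) fun j _ _ => by
      linarith [h.mul_le m j, h.le_one j]
  have h2 : ∑ j, (1 - B m j * y j) = Fintype.card V - lam := by
    rw [Finset.sum_sub_distrib, ← h.eigen m, h.max]
    simp
  linarith [h.card_lt]

variable [DecidableEq V]

lemma deficiency_lt_two (h : IsDominantVector B y lam m) {K : Finset V} (hm : m ∉ K) :
    ∑ j ∈ K, (1 - y j) < 2 := by
  have h1 := h.deficiency_lt (insert m K)
  rw [Finset.sum_insert hm, h.diag] at h1
  have h2 : ∑ j ∈ K, (1 - y j) ≤ ∑ j ∈ K, (1 - B m j * y j) :=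
    Finset.sum_le_sum fun j _ => by linarith [h.mul_le m j]
  linarith

lemma deficiency_lt_one (h : IsDominantVector B y lam m) {K : Finset V} {v : V}
    (hv : B m v ≠ 1) (hvm : v ≠ m) (hm : m ∉ K) (hvK : v ∉ K) :
    ∑ j ∈ K, (1 - y j) < 1 := by
  have h1 := h.deficiency_lt (insert v (insert m K))
  rw [Finset.sum_insert (by simp [hvm, hvK]), Finset.sum_insert hm, h.diag] at h1
  have h2 : ∑ j ∈ K, (1 - y j) ≤ ∑ j ∈ K, (1 - B m j * y j) :=
    Finset.sum_le_sum fun j _ => by linarith [h.mul_le m j]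
  linarith [h.mul_le_zero hv]

lemma pos_of_ne (h : IsDominantVector B y lam m) {v z : V}
    (hv : B m v ≠ 1) (hvm : v ≠ m) (hz : z ≠ v) (hzm : z ≠ m) : B m z = 1 := by
  by_contra hc
  have h1 := h.deficiency_lt {m, v, z}
  rw [Finset.sum_insert (by simp [hvm.symm, hzm.symm]), Finset.sum_insert (by simp [hz.symm]),
    Finset.sum_singleton, h.diag] at h1
  linarith [h.mul_le_zero hv, h.mul_le_zero hc]

lemma eigen_le_sum (h : IsDominantVector B y lam m) {i : V} {N : Finset V}
    (hN : ∀ v, B i v = 1 → v ∈ N) : 9 * y i ≤ ∑ v ∈ N, y v := by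
  have h1 : ∑ j, B i j * y j ≤ ∑ j, if j ∈ N then y j else 0 :=
    Finset.sum_le_sum fun j _ => by
      split_ifs with hj
      · exact h.mul_le i j
      · exact h.mul_le_zero fun e => hj (hN j e)
  rw [← h.eigen, Finset.sum_ite_mem, Finset.univ_inter] at h1
  nlinarith [h.nonneg i, h.nine_le]

lemma eigen_add_le_sum (h : IsDominantVector B y lam m) {i k : V} {N : Finset V}
    (hk : B i k = -1) (hN : ∀ v, B i v = 1 → v ∈ N) (hkN : k ∉ N) :
    9 * y i + y k ≤ ∑ v ∈ N, y v := by
  have h1 : ∑ j, B i j * y j ≤ ∑ j, ((if j ∈ N then y j else 0) - if j = k then y j else 0) :=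
    Finset.sum_le_sum fun j _ => by
      split_ifs with hj hjk hjk
      · exact absurd hj (hjk ▸ hkN)
      · simpa using h.mul_le i j
      · rw [hjk, hk]; linarith
      · simpa using h.mul_le_zero fun e => hj (hN j e)
  rw [← h.eigen, Finset.sum_sub_distrib, Finset.sum_ite_mem, Finset.univ_inter] at h1
  simp only [Finset.sum_ite_eq', Finset.mem_univ, if_true] at h1
  nlinarith [h.nonneg i, h.nine_le]

lemma nine_mul_le_card (h : IsDominantVector B y lam m) {i : V} {N : Finset V} {d : ℕ}
    (hN : ∀ v, B i v = 1 → v ∈ N) (hd : N.card ≤ d) : 9 * y i ≤ d := by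
  have h1 := h.eigen_le_sum hN
  have h2 : ∑ v ∈ N, y v ≤ ∑ v ∈ N, 1 := Finset.sum_le_sum fun v _ => h.le_one v
  have h3 : (N.card : ℝ) ≤ d := by exact_mod_cast hd
  simp at h2
  linarith

lemma deficiency_pair (h : IsDominantVector B y lam m) {v p q : V}
    (hv : B m v ≠ 1) (hvm : v ≠ m) (hpq : p ≠ q) (hpm : p ≠ m) (hqm : q ≠ m) (hpv : p ≠ v)
    (hqv : q ≠ v) : 1 < y p + y q := by
  have := h.deficiency_lt_one (K := {p, q}) hv hvm (by simp [hpm.symm, hqm.symm])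
    (by simp [hpv.symm, hqv.symm])
  rw [Finset.sum_pair hpq] at this
  linarith

lemma deficiency_triple (h : IsDominantVector B y lam m) {p q r : V}
    (hpq : p ≠ q) (hpr : p ≠ r) (hqr : q ≠ r) (hpm : p ≠ m) (hqm : q ≠ m) (hrm : r ≠ m) :
    1 < y p + y q + y r := by
  have := h.deficiency_lt_two (K := {p, q, r}) (by simp [hpm.symm, hqm.symm, hrm.symm])
  rw [Finset.sum_insert (by simp [hpq, hpr]), Finset.sum_pair hqr] at this
  linarith

/-- The maximum is not attained at an end of a negative edge whose other end has a positive
neighbour. -/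
lemma ne_end (h : IsDominantVector B y lam m) {u w c : V} (huw : B u w = -1)
    (hP : NoPosPath B u w) (hc : B w c = 1) : m ≠ u := by
  rintro rfl
  have hwm : B m w ≠ 1 := by rw [huw]; norm_num
  have hwu : B w m = -1 := by rw [h.symm, huw]
  have hne : w ≠ m := by rintro rfl; rw [h.diag] at huw; norm_num at huw
  have ne_m : ∀ c, B w c = 1 → c ≠ m := by
    rintro c hc rfl; rw [hwu] at hc; norm_num at hc
  have low : ∀ c, B w c = 1 → 9 * y c ≤ 2 := by
    intro c hc
    have hcm := ne_m c hc
    have hcw := (h.ne_of_pos hc).symm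
    have leaf : ∀ b, b ≠ m → b ≠ w → B b c = 1 → 9 * y b ≤ 3 := by
      intro b hbm hbw hbc
      refine h.nine_mul_le_card (N := {m, w, c}) (d := 3) (fun v hv => ?_) Finset.card_le_three
      by_contra hv'
      simp only [Finset.mem_insert, Finset.mem_singleton, not_or] at hv'
      exact hP v b c hbm hbw hv'.2.2 (h.pos_of_ne hwm hne hv'.2.1 hv'.1) (by rw [h.symm, hv]) hbc
        (by rw [h.symm, hc])
    by_cases hb : ∃ b, b ≠ m ∧ b ≠ w ∧ B b c = 1
    · obtain ⟨b, hbm, hbw, hbc⟩ := hb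
      have h3 := leaf b hbm hbw hbc
      have hcN : 9 * y c ≤ (3 : ℕ) := by
        refine h.nine_mul_le_card (N := {m, w, b}) (fun v hv => ?_) Finset.card_le_three
        by_contra hv'
        simp only [Finset.mem_insert, Finset.mem_singleton, not_or] at hv'
        have h4 := leaf v hv'.1 hv'.2.1 (by rw [h.symm, hv])
        linarith [h.deficiency_pair hwm hne hv'.2.2 hv'.1 hbm hv'.2.1 hbw]
      push_cast at hcN
      linarith [h.deficiency_pair hwm hne (h.ne_of_pos hbc) hbm hcm hbw hcw]
    · push Not at hb
      refine h.nine_mul_le_card (N := {m, w}) (d := 2) (fun v hv => ?_) Finset.card_le_two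
      by_contra hv'
      simp only [Finset.mem_insert, Finset.mem_singleton, not_or] at hv'
      exact hb v hv'.1 hv'.2 (by rw [h.symm, hv])
  have hT : ∀ v, B w v = 1 → v ∈ ({c} : Finset V) := by
    intro v hv
    rw [Finset.mem_singleton]
    by_contra hvc
    linarith [low c hc, low v hv, h.deficiency_pair hwm hne hvc (ne_m v hv) (ne_m c hc)
      (h.ne_of_pos hv).symm (h.ne_of_pos hc).symm]
  have := h.eigen_add_le_sum hwu hT (by simpa using (ne_m c hc).symm)
  rw [Finset.sum_singleton, h.max] at this
  linarith [low c hc, h.nonneg w]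

/-- A vertex of maximum weight adjacent to one end of the negative edge is adjacent to both. -/
lemma pos_both (h : IsDominantVector B y lam m) {u w a : V} (huw : B u w = -1)
    (hP : NoPosPath B u w) (hmu : m ≠ u) (hmw : B m w = 1) (ha : B u a = 1) :
    B m u = 1 := by
  by_contra hm
  have ham : ∀ a, B u a = 1 → a ≠ m := by
    rintro a ha rfl; exact hm (by rw [h.symm, ha])
  have haw : ∀ a, B u a = 1 → a ≠ w := by
    rintro a ha rfl; rw [huw] at ha; norm_num at ha
  have low : ∀ a, B u a = 1 → 9 * y a ≤ 3 := by
    intro a ha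
    refine h.nine_mul_le_card (N := {u, w, m}) (d := 3) (fun v hv => ?_) Finset.card_le_three
    by_contra hv'
    simp only [Finset.mem_insert, Finset.mem_singleton, not_or] at hv'
    exact hP a v m hv'.1 hv'.2.1 (ham a ha) ha hv
      (by rw [h.symm, h.pos_of_ne hm hmu.symm hv'.1 hv'.2.2]) hmw
  have hS : ∀ v, B u v = 1 → v ∈ ({a} : Finset V) := by
    intro v hv
    rw [Finset.mem_singleton]
    by_contra hva
    linarith [low a ha, low v hv, h.deficiency_pair hm hmu.symm hva (ham v hv) (ham a ha)
      (h.ne_of_pos hv).symm (h.ne_of_pos ha).symm]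
  have h1 := h.eigen_add_le_sum huw hS (by simpa using (haw a ha).symm)
  rw [Finset.sum_singleton] at h1
  have hwu : w ≠ u := by rintro rfl; rw [h.diag] at huw; norm_num at huw
  linarith [low a ha, h.nonneg u, h.deficiency_pair hm hmu.symm (haw a ha) (ham a ha)
      (h.ne_of_pos hmw).symm (h.ne_of_pos ha).symm hwu]

/-- If a vertex of maximum weight is adjacent to both ends of the negative edge, then it is the
only vertex adjacent to one of them. -/
lemma eq_of_pos_both (h : IsDominantVector B y lam m) {u w : V} (huw : B u w = -1)
    (hP : NoPosPath B u w) (hmu : B m u = 1) (hmw : B m w = 1) {c : V}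
    (hc : B u c = 1 ∨ B w c = 1) : c = m := by
  by_contra hcm
  have hne : u ≠ w := by rintro rfl; rw [h.diag] at huw; norm_num at huw
  have hwu : B w u = -1 := by rw [h.symm, huw]
  have low : ∀ c, (B u c = 1 ∨ B w c = 1) → c ≠ m → 9 * y c ≤ 4 := by
    intro c hc hcm
    have key : ∀ v, v ≠ u → v ≠ w → v ≠ m → B c v = 1 → B m v ≠ 1 := by
      intro v hvu hvw hvm hcv hmv
      rcases hc with hc | hc
      · exact hP c v m hvu hvw hcm hc hcv (by rw [h.symm, hmv]) hmw
      · exact hP m v c hvu hvw (Ne.symm hcm) (by rw [h.symm, hmu]) hmv (by rw [h.symm, hcv])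
          (by rw [h.symm, hc])
    by_cases hz : ∃ z, z ≠ m ∧ B m z ≠ 1
    · obtain ⟨z, hzm, hz⟩ := hz
      refine h.nine_mul_le_card (N := {u, w, m, z}) (d := 4) (fun v hv => ?_) Finset.card_le_four
      by_contra hv'
      simp only [Finset.mem_insert, Finset.mem_singleton, not_or] at hv'
      exact key v hv'.1 hv'.2.1 hv'.2.2.1 hv (h.pos_of_ne hz hzm hv'.2.2.2 hv'.2.2.1)
    · push Not at hz
      refine h.nine_mul_le_card (N := {u, w, m}) (d := 4) (fun v hv => ?_)
        (Finset.card_le_three.trans (by norm_num))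
      by_contra hv'
      simp only [Finset.mem_insert, Finset.mem_singleton, not_or] at hv'
      exact key v hv'.1 hv'.2.1 hv'.2.2 hv (hz v hv'.2.2)
  classical
  set K : Finset V := Finset.univ.filter fun v => (B u v = 1 ∨ B w v = 1) ∧ v ≠ m with hK
  have hmK : m ∉ K := by simp [hK]
  have hlowK : ∀ v ∈ K, y v ≤ 4 / 9 := by
    intro v hv
    simp only [hK, Finset.mem_filter, Finset.mem_univ, true_and] at hv
    linarith [low v hv.1 hv.2]
  have hcard : (K.card : ℝ) ≤ 3 := by
    have h1 := h.deficiency_lt_two hmK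
    have h2 : ∑ v ∈ K, (5 / 9 : ℝ) ≤ ∑ v ∈ K, (1 - y v) :=
      Finset.sum_le_sum fun v hv => by linarith [hlowK v hv]
    rw [Finset.sum_const, nsmul_eq_mul] at h2
    have h3 : (K.card : ℝ) < (4 : ℕ) := by push_cast; linarith
    have h4 : K.card ≤ 3 := by
      have := Nat.cast_lt.mp h3
      omega
    exact_mod_cast h4
  have hsum : ∑ v ∈ insert m K, y v ≤ 7 / 3 := by
    rw [Finset.sum_insert hmK, h.max]
    have h2 : ∑ v ∈ K, y v ≤ ∑ v ∈ K, (4 / 9 : ℝ) := Finset.sum_le_sum hlowK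
    rw [Finset.sum_const, nsmul_eq_mul] at h2
    linarith
  have hu : 9 * y u ≤ ∑ v ∈ insert m K, y v := h.eigen_le_sum fun v hv => by
    by_cases e : v = m <;> simp [hK, e, hv]
  have hw : 9 * y w ≤ ∑ v ∈ insert m K, y v := h.eigen_le_sum fun v hv => by
    by_cases e : v = m <;> simp [hK, e, hv]
  have hcu : c ≠ u := by
    rintro rfl
    rcases hc with hc | hc
    · exact h.ne_of_pos hc rfl
    · rw [hwu] at hc; norm_num at hc
  have hcw : c ≠ w := by
    rintro rfl
    rcases hc with hc | hc
    · rw [huw] at hc; norm_num at hc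
    · exact h.ne_of_pos hc rfl
  linarith [low c hc hcm, h.deficiency_triple hne hcu.symm hcw.symm
    (h.ne_of_pos hmu).symm (h.ne_of_pos hmw).symm hcm]

/-- Both ends of a negative edge have a positive neighbour. -/
lemma exists_pos (h : IsDominantVector B y lam m) {u w : V} (huw : B u w = -1) :
    ∃ a, B u a = 1 := by
  by_contra! hc
  have h1 := h.eigen_add_le_sum (N := ∅) huw (fun v hv => absurd hv (hc v)) (by simp)
  rw [Finset.sum_empty] at h1
  have hu : y u = 0 := by linarith [h.nonneg u, h.nonneg w]
  have hw : y w = 0 := by linarith [h.nonneg u, h.nonneg w]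
  have hne : u ≠ w := by rintro rfl; rw [h.diag] at huw; norm_num at huw
  have hum : m ≠ u := by rintro rfl; linarith [h.max]
  have hwm : m ≠ w := by rintro rfl; linarith [h.max]
  have := h.deficiency_lt_two (K := {u, w}) (by simp [hum, hwm])
  rw [Finset.sum_pair hne] at this
  linarith

/-- The ends of a negative edge in no negative pentagon have a unique positive neighbour, which
is common to both. -/
lemma unique_pos (h : IsDominantVector B y lam m) {u w : V} (huw : B u w = -1)
    (hP : NoPosPath B u w) :
    B u m = 1 ∧ B w m = 1 ∧ ∀ c, (B u c = 1 ∨ B w c = 1) → c = m := by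
  have hwu : B w u = -1 := by rw [h.symm, huw]
  have hP' := hP.symm h.symm
  obtain ⟨a, ha⟩ := h.exists_pos huw
  obtain ⟨c, hc⟩ := h.exists_pos hwu
  have hmu := h.ne_end huw hP hc
  have hmw := h.ne_end hwu hP' ha
  have hne : u ≠ w := by rintro rfl; rw [h.diag] at huw; norm_num at huw
  have hboth : B m u = 1 ∧ B m w = 1 := by
    by_cases h1 : B m u = 1
    · exact ⟨h1, h.pos_both hwu hP' hmw h1 hc⟩
    · have h2 := h.pos_of_ne h1 hmu.symm hne.symm hmw.symm
      exact ⟨h.pos_both huw hP hmu h2 ha, h2⟩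
  exact ⟨by rw [h.symm, hboth.1], by rw [h.symm, hboth.2],
    fun c => h.eq_of_pos_both huw hP hboth.1 hboth.2⟩

end IsDominantVector

/-- The signed adjacency matrix of an all-positive clique on the vertices other than `u` and `w`,
with an unbalanced triangle `u w c` attached at the vertex `c`. -/
def cliqueTriangle {V : Type*} [DecidableEq V] (u w c i j : V) : ℝ :=
  if i = j then 0
  else if (i = u ∧ j = w) ∨ (i = w ∧ j = u) then -1
  else if ((i = u ∨ i = w) ∧ j = c) ∨ ((j = u ∨ j = w) ∧ i = c) then 1
  else if ¬(i = u ∨ i = w) ∧ ¬(j = u ∨ j = w) then 1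
  else 0

section cliqueTriangle

variable {V : Type*} [DecidableEq V] {u w c : V}

lemma cliqueTriangle_left (huw : u ≠ w) (huc : u ≠ c) (hwc : w ≠ c) (j : V) :
    cliqueTriangle u w c u j = (if j = c then 1 else 0) - if j = w then 1 else 0 := by
  unfold cliqueTriangle
  grind

lemma cliqueTriangle_right (huw : u ≠ w) (huc : u ≠ c) (hwc : w ≠ c) (j : V) :
    cliqueTriangle u w c w j = (if j = c then 1 else 0) - if j = u then 1 else 0 := by
  unfold cliqueTriangle
  grind

lemma cliqueTriangle_clique (huc : u ≠ c) (hwc : w ≠ c) {i : V} (hu : i ≠ u)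
    (hw : i ≠ w) (huw : u ≠ w) (j : V) :
    cliqueTriangle u w c i j = 1 - (if j = i then 1 else 0)
      + (if j = u then (if i = c then 1 else 0) - 1 else 0)
      + (if j = w then (if i = c then 1 else 0) - 1 else 0) := by
  unfold cliqueTriangle
  grind

/-- The test vector for `cliqueTriangle` with entries `t` at `u` and `w`, and `1` elsewhere. -/
def testVector (u w : V) (t : ℝ) (i : V) : ℝ := if i = u ∨ i = w then t else 1

lemma sum_cliqueTriangle_testVector [Fintype V] (huw : u ≠ w) (huc : u ≠ c) (hwc : w ≠ c)
    (t : ℝ) (i : V) :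
    ∑ j, cliqueTriangle u w c i j * testVector u w t j =
      if i = u ∨ i = w then 1 - t else (Fintype.card V - 3) + if i = c then 2 * t else 0 := by
  have hu : testVector u w t u = t := by simp [testVector]
  have hw : testVector u w t w = t := by simp [testVector]
  have hx : ∀ i, i ≠ u → i ≠ w → testVector u w t i = 1 := by
    intro i h1 h2; simp [testVector, h1, h2]
  have hsum : ∑ j, testVector u w t j = Fintype.card V - 2 + 2 * t := by
    have : ∀ j, testVector u w t j =
        1 + (if j = u then t - 1 else 0) + if j = w then t - 1 else 0 := by
      intro j; unfold testVector; grind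
    simp only [this, Finset.sum_add_distrib, Finset.sum_ite_eq', Finset.mem_univ, if_true]
    simp
    ring
  by_cases h1 : i = u
  · subst h1
    simp [cliqueTriangle_left huw huc hwc, sub_mul, Finset.sum_sub_distrib, hw,
      hx c huc.symm hwc.symm]
  by_cases h2 : i = w
  · subst h2
    simp [cliqueTriangle_right huw huc hwc, sub_mul, Finset.sum_sub_distrib, hu,
      hx c huc.symm hwc.symm]
  simp only [cliqueTriangle_clique huc hwc h1 h2 huw, sub_mul, add_mul, one_mul, ite_mul, zero_mul,
    Finset.sum_sub_distrib, Finset.sum_add_distrib, Finset.sum_ite_eq', Finset.mem_univ, if_true,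
    hu, hw, hx i h1 h2, hsum, h1, h2, or_self, if_false]
  split_ifs <;> ring

lemma card_mul_lt_cliqueTriangle [Fintype V] (hV : 3 ≤ Fintype.card V)
    (huw : u ≠ w) (huc : u ≠ c) (hwc : w ≠ c) :
    ∃ x : V → ℝ, (Fintype.card V - 3) * ∑ i, x i * x i <
      ∑ i, x i * ∑ j, cliqueTriangle u w c i j * x j := by
  have hN : (3 : ℝ) ≤ Fintype.card V := by exact_mod_cast hV
  set N : ℝ := (Fintype.card V : ℝ) with hNdef
  set t : ℝ := 1 / (N - 2) with ht
  have htN : t * (N - 2) = 1 := by rw [ht]; field_simp [show N - 2 ≠ 0 by linarith]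
  have htpos : 0 < t := by rw [ht]; apply one_div_pos.mpr; linarith
  refine ⟨testVector u w t, ?_⟩
  simp only [sum_cliqueTriangle_testVector huw huc hwc]
  rw [← sub_pos, Finset.mul_sum, ← Finset.sum_sub_distrib]
  have : ∀ i, (testVector u w t i * if i = u ∨ i = w then 1 - t else
      (N - 3) + if i = c then 2 * t else 0) - (N - 3) * (testVector u w t i * testVector u w t i)
      = (if i = c then 2 * t else 0) + (if i = u then t * (1 - t) - (N - 3) * (t * t) else 0)
        + if i = w then t * (1 - t) - (N - 3) * (t * t) else 0 := by
    intro i; unfold testVector; grind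
  simp only [← hNdef, this, Finset.sum_add_distrib, Finset.sum_ite_eq', Finset.mem_univ, if_true]
  nlinarith

end cliqueTriangle

section spectral

open Matrix

variable {n : ℕ} {A : Matrix (Fin n) (Fin n) ℝ}

lemma posSemidef_lam1_sub (hA : A.IsHermitian) :
    (algebraMap ℝ (Matrix (Fin n) (Fin n) ℝ) (lam1 A hA) - A).PosSemidef := by
  rw [posSemidef_iff_isHermitian_and_spectrum_nonneg]
  constructor
  · refine IsHermitian.sub ?_ hA
    rw [algebraMap_eq_diagonal]
    exact isHermitian_diagonal _
  · rw [← spectrum.singleton_sub_eq, hA.spectrum_real_eq_range_eigenvalues]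
    rintro _ ⟨a, ha, _, ⟨i, rfl⟩, rfl⟩
    rw [Set.mem_singleton_iff] at ha
    subst ha
    have hi : hA.eigenvalues i ≤ lam1 A hA := le_ciSup (Set.finite_range _).bddAbove i
    exact sub_nonneg.mpr hi

lemma algebraMap_sub_mulVec (r : ℝ) (x : Fin n → ℝ) (i : Fin n) :
    ((algebraMap ℝ (Matrix (Fin n) (Fin n) ℝ) r - A) *ᵥ x) i = r * x i - ∑ j, A i j * x j := by
  rw [sub_mulVec, Algebra.algebraMap_eq_smul_one, smul_mulVec, one_mulVec]
  simp [mulVec, dotProduct]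

lemma rayleigh_le_lam1 (hA : A.IsHermitian) (x : Fin n → ℝ) :
    ∑ i, x i * ∑ j, A i j * x j ≤ lam1 A hA * ∑ i, x i * x i := by
  have h := (posSemidef_lam1_sub hA).dotProduct_mulVec_nonneg x
  simp only [dotProduct, algebraMap_sub_mulVec, star_trivial, mul_sub,
    Finset.sum_sub_distrib] at h
  rw [Finset.mul_sum]
  have : ∀ i, lam1 A hA * (x i * x i) = x i * (lam1 A hA * x i) := fun i => by ring
  simp only [this]
  linarith

lemma eigen_of_rayleigh_eq (hA : A.IsHermitian) (x : Fin n → ℝ)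
    (h : lam1 A hA * ∑ i, x i * x i ≤ ∑ i, x i * ∑ j, A i j * x j) (i : Fin n) :
    lam1 A hA * x i = ∑ j, A i j * x j := by
  have h1 := le_antisymm h (rayleigh_le_lam1 hA x)
  have h2 := ((posSemidef_lam1_sub hA).dotProduct_mulVec_zero_iff x).mp (by
    simp only [dotProduct, algebraMap_sub_mulVec, star_trivial, mul_sub, Finset.sum_sub_distrib]
    rw [← h1, Finset.mul_sum]
    have : ∀ i, lam1 A hA * (x i * x i) = x i * (lam1 A hA * x i) := fun i => by ring
    simp only [this, sub_self])
  have h3 := congrFun h2 i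
  rw [algebraMap_sub_mulVec] at h3
  simpa [sub_eq_zero] using h3

lemma exists_eigenvector_lam1 [NeZero n] (hA : A.IsHermitian) :
    ∃ z : Fin n → ℝ, z ≠ 0 ∧ ∀ i, lam1 A hA * z i = ∑ j, A i j * z j := by
  obtain ⟨k, hk⟩ := exists_eq_ciSup_of_finite (f := hA.eigenvalues)
  refine ⟨⇑(hA.eigenvectorBasis k), ?_, fun i => ?_⟩
  · intro h0
    exact hA.eigenvectorBasis.orthonormal.ne_zero k (by ext i; exact congrFun h0 i)
  · have := congrFun (hA.mulVec_eigenvectorBasis k) i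
    simp only [mulVec, dotProduct, Pi.smul_apply, smul_eq_mul] at this
    rw [this, hk, lam1]

end spectral

section gamma1

variable {n : ℕ}

lemma gamma1_apply_equiv {V : Type*} [DecidableEq V] {u w c : V} (e : V ≃ Fin n)
    (hu : (e u).val = 0) (hw : (e w).val = 1) (hc : (e c).val = 2) (i j : V) :
    gamma1 n (e i) (e j) = cliqueTriangle u w c i j := by
  have h0 : ∀ i, (e i).val = 0 ↔ i = u := fun i => by rw [← hu, Fin.val_inj, e.injective.eq_iff]
  have h1 : ∀ i, (e i).val = 1 ↔ i = w := fun i => by rw [← hw, Fin.val_inj, e.injective.eq_iff]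
  have h2 : ∀ i, (e i).val = 2 ↔ i = c := fun i => by rw [← hc, Fin.val_inj, e.injective.eq_iff]
  have hle : ∀ i, (e i).val ≤ 1 ↔ i = u ∨ i = w := fun i => by rw [← h0, ← h1]; omega
  have hge : ∀ i, 2 ≤ (e i).val ↔ ¬(i = u ∨ i = w) := fun i => by rw [← h0, ← h1]; omega
  simp only [gamma1, cliqueTriangle, e.injective.eq_iff, h0, h1, h2, hle, hge]

lemma card_sub_three_lt_lam1_gamma1 (hn : 3 ≤ n) (hG : (gamma1 n).IsHermitian) :
    (n : ℝ) - 3 < lam1 (gamma1 n) hG := by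
  obtain ⟨x, hx⟩ := card_mul_lt_cliqueTriangle (V := Fin n) (u := ⟨0, by omega⟩)
    (w := ⟨1, by omega⟩) (c := ⟨2, by omega⟩) (by simpa using hn) (by simp) (by simp) (by simp)
  have h := rayleigh_le_lam1 hG x
  have he : ∀ i j, gamma1 n i j = cliqueTriangle _ _ _ i j :=
    gamma1_apply_equiv (u := ⟨0, by omega⟩) (w := ⟨1, by omega⟩) (c := ⟨2, by omega⟩)
      (Equiv.refl (Fin n)) rfl rfl rfl
  simp only [he] at h
  rw [Fintype.card_fin] at hx
  exact lt_of_mul_lt_mul_right (hx.trans_le h) (Finset.sum_nonneg fun i _ => mul_self_nonneg _)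

lemma exists_equiv_fin (hn : 3 ≤ n) {u w c : Fin n} (huw : u ≠ w) (huc : u ≠ c) (hwc : w ≠ c) :
    ∃ e : Fin n ≃ Fin n, (e u).val = 0 ∧ (e w).val = 1 ∧ (e c).val = 2 := by
  have hinj : Function.Injective ![u, w, c] := by
    intro i j
    fin_cases i <;> fin_cases j <;> simp [huw, huc, hwc, huw.symm, huc.symm, hwc.symm]
  have := Equiv.Perm.isMultiplyPretransitive (Fin n) 3
  obtain ⟨e, he⟩ := MulAction.exists_smul_eq (Equiv.Perm (Fin n))
    (⟨_, hinj⟩ : Fin 3 ↪ Fin n) (Fin.castLEEmb hn)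
  exact ⟨e, congrArg Fin.val (DFunLike.congr_fun he 0), congrArg Fin.val (DFunLike.congr_fun he 1),
    congrArg Fin.val (DFunLike.congr_fun he 2)⟩

/-- A signed graph that contains a negative edge whose ends have a unique common positive
neighbour, and whose index is at least that of `gamma1`, is isomorphic to `gamma1`. -/
lemma IsDominantVector.exists_equiv_gamma1 (hn : 3 ≤ n) {B : Fin n → Fin n → ℝ} {y : Fin n → ℝ}
    {lam : ℝ} {m u w : Fin n} (h : IsDominantVector B y lam m) (hG : (gamma1 n).IsHermitian)
    (hlam : lam1 (gamma1 n) hG ≤ lam) (huw : B u w = -1) (hP : NoPosPath B u w) :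
    ∃ e : Fin n ≃ Fin n, ∀ i j, B i j = gamma1 n (e i) (e j) := by
  obtain ⟨hum, hwm, huniq⟩ := h.unique_pos huw hP
  have hwu : B w u = -1 := by rw [h.symm, huw]
  have hne : u ≠ w := by rintro rfl; rw [h.diag] at huw; norm_num at huw
  have hmu := h.ne_of_pos hum
  have hmw := h.ne_of_pos hwm
  obtain ⟨e, he0, he1, he2⟩ := exists_equiv_fin hn hne hmu hmw
  have hgam := gamma1_apply_equiv e he0 he1 he2
  refine ⟨e, fun i j => ?_⟩
  rw [hgam]
  set C := cliqueTriangle u w m with hC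
  have hCsymm : ∀ i j, C i j = C j i := fun i j => by rw [hC]; unfold cliqueTriangle; grind
  have hle : ∀ i j, B i j ≤ C i j := by
    intro i j
    have h1 : B i j ≤ 1 := by rcases h.entry i j with e | e | e <;> rw [e] <;> norm_num
    have h2 : B i j ≠ 1 → B i j ≤ 0 := by
      intro h'
      rcases h.entry i j with e | e | e
      · exact e.le
      · exact absurd e h'
      · rw [e]; norm_num
    have h3 := huniq i
    have h4 := huniq j
    have h5 := h.symm i j
    have h6 := h.diag i
    rw [hC]; unfold cliqueTriangle
    grind
  have heig : ∀ i, lam1 (gamma1 n) hG * y i = ∑ j, C i j * y j := by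
    have hsum : ∀ i, ∑ j, gamma1 n i j * y (e.symm j) = ∑ j, C (e.symm i) j * y j := by
      intro i
      rw [← e.sum_comp]
      refine Finset.sum_congr rfl fun j _ => ?_
      rw [← hgam, e.apply_symm_apply, e.symm_apply_apply]
    have key := eigen_of_rayleigh_eq hG (fun i => y (e.symm i)) (by
      simp only [hsum]
      rw [e.symm.sum_comp (fun i => y i * y i), e.symm.sum_comp (fun i => y i * ∑ j, C i j * y j)]
      calc lam1 (gamma1 n) hG * ∑ i, y i * y i ≤ lam * ∑ i, y i * y i :=
            mul_le_mul_of_nonneg_right hlam (Finset.sum_nonneg fun i _ => mul_self_nonneg _)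
        _ = ∑ i, y i * ∑ j, B i j * y j := by
            rw [Finset.mul_sum]
            refine Finset.sum_congr rfl fun i _ => ?_
            rw [← h.eigen]; ring
        _ ≤ _ := Finset.sum_le_sum fun i _ => mul_le_mul_of_nonneg_left
            (Finset.sum_le_sum fun j _ => mul_le_mul_of_nonneg_right (hle i j) (h.nonneg j))
            (h.nonneg i))
    intro i
    have := key (e i)
    rwa [hsum, e.symm_apply_apply] at this
  have hterm : ∀ i j, B i j * y j = C i j * y j := by
    intro i j
    have hle' : ∀ j ∈ Finset.univ, B i j * y j ≤ C i j * y j := fun j _ =>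
      mul_le_mul_of_nonneg_right (hle i j) (h.nonneg j)
    refine (Finset.sum_eq_sum_iff_of_le hle').mp ?_ j (Finset.mem_univ j)
    refine le_antisymm (Finset.sum_le_sum hle') ?_
    rw [← h.eigen, ← heig]
    exact mul_le_mul_of_nonneg_right hlam (h.nonneg i)
  have hu9 := h.nine_mul_le_card (i := u) (N := {m}) (d := 1) (fun v hv => by
    simpa using huniq v (Or.inl hv)) (by simp)
  have hw9 := h.nine_mul_le_card (i := w) (N := {m}) (d := 1) (fun v hv => by
    simpa using huniq v (Or.inr hv)) (by simp)
  push_cast at hu9 hw9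
  have hupos : y u ≠ 0 := by
    intro h0
    have := heig u
    simp only [hC, cliqueTriangle_left hne hmu hmw, sub_mul, ite_mul, one_mul, zero_mul,
      Finset.sum_sub_distrib, Finset.sum_ite_eq', Finset.mem_univ, if_true, h0, h.max] at this
    linarith
  have hwpos : y w ≠ 0 := by
    intro h0
    have := heig w
    simp only [hC, cliqueTriangle_right hne hmu hmw, sub_mul, ite_mul, one_mul, zero_mul,
      Finset.sum_sub_distrib, Finset.sum_ite_eq', Finset.mem_univ, if_true, h0, h.max] at this
    linarith
  have hpos : y j ≠ 0 := by
    intro h0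
    have h1 : j ≠ u := by rintro rfl; exact hupos h0
    have h2 : j ≠ w := by rintro rfl; exact hwpos h0
    have h3 : j ≠ m := by rintro rfl; linarith [h.max]
    linarith [h.deficiency_triple hne h1.symm h2.symm hmu hmw h3]
  exact mul_right_cancel₀ hpos (hterm i j)

end gamma1

section walkSign

variable {V : Type*} {G : SimpleGraph V} {σ : V → V → ℝ} {s : V → ℝ}

@[simp]
lemma walkSign_cons {u v w : V} (h : G.Adj u v) (p : G.Walk v w) :
    walkSign σ (p.cons h) = σ u v * walkSign σ p := by
  simp [walkSign]

@[simp]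
lemma walkSign_nil {u : V} : walkSign σ (SimpleGraph.Walk.nil : G.Walk u u) = 1 := by
  simp [walkSign]

lemma walkSign_eq_of_switching (hs : ∀ v, s v = 1 ∨ s v = -1)
    (h : ∀ i j, G.Adj i j → s i * σ i j * s j = 1) {u v : V} (p : G.Walk u v) :
    walkSign σ p = s u * s v := by
  induction p with
  | nil => rename_i u; rcases hs u with e | e <;> simp [e]
  | cons hadj p ih =>
    rename_i a b c
    have h1 := h _ _ hadj
    rw [walkSign_cons, ih]
    have h2 : s a * s a = 1 := by rcases hs a with e | e <;> simp [e]
    linear_combination (s a * s c) * h1 - (σ a b * s b * s c) * h2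

lemma exists_negative_pentagon (hs : ∀ v, s v = 1 ∨ s v = -1) {u a b c w : V}
    (hua : G.Adj u a) (hab : G.Adj a b) (hbc : G.Adj b c) (hcw : G.Adj c w) (hwu : G.Adj w u)
    (hub : u ≠ b) (huc : u ≠ c) (hac : a ≠ c) (haw : a ≠ w) (hbw : b ≠ w)
    (h1 : s u * σ u a * s a = 1) (h2 : s a * σ a b * s b = 1) (h3 : s b * σ b c * s c = 1)
    (h4 : s c * σ c w * s w = 1) (h5 : s w * σ w u * s u = -1) :
    ∃ (v : V) (p : G.Walk v v), p.IsCycle ∧ p.length = 5 ∧ walkSign σ p = -1 := by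
  refine ⟨u, .cons hua (.cons hab (.cons hbc (.cons hcw (.cons hwu .nil)))), ?_, by simp, ?_⟩
  · have := hua.ne; have := hab.ne; have := hbc.ne; have := hcw.ne; have := hwu.ne
    rw [SimpleGraph.Walk.cons_isCycle_iff]
    simp [SimpleGraph.Walk.cons_isPath_iff]
    grind
  · have sq : ∀ v, s v * s v = 1 := fun v => by rcases hs v with e | e <;> simp [e]
    have h6 : (s u * s u) * (s a * s a) * (s b * s b) * (s c * s c) * (s w * s w) *
        (σ u a * (σ a b * (σ b c * (σ c w * (σ w u * 1))))) = -1 := by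
      calc _ = (s u * σ u a * s a) * (s a * σ a b * s b) * (s b * σ b c * s c) *
            (s c * σ c w * s w) * (s w * σ w u * s u) := by ring
        _ = -1 := by rw [h1, h2, h3, h4, h5]; norm_num
    simpa [sq] using h6

end walkSign

/-- Let `Γ` be an unbalanced signed graph of order `n ≥ 12`. If `λ₁(Γ) ≥ λ₁(Γ₁)`, then `Γ`
contains a negative 5-cycle, unless `Γ` is switching equivalent (up to isomorphism) to `Γ₁`. -/
theorem stmt14 {n : ℕ} (hn : 12 ≤ n) (G : SimpleGraph (Fin n)) [DecidableRel G.Adj]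
    (σ : Fin n → Fin n → ℝ)
    (hsym : ∀ i j, σ i j = σ j i)
    (hval : ∀ i j, G.Adj i j → σ i j = 1 ∨ σ i j = -1)
    (A : Matrix (Fin n) (Fin n) ℝ)
    (hAdef : A = fun i j => if G.Adj i j then σ i j else 0)
    (hA : A.IsHermitian) (hG1 : (gamma1 n).IsHermitian)
    (hunbal : ∃ (v : Fin n) (p : G.Walk v v), p.IsCycle ∧ walkSign σ p = -1)
    (hlam : lam1 (gamma1 n) hG1 ≤ lam1 A hA) :
    (∃ (v : Fin n) (p : G.Walk v v), p.IsCycle ∧ p.length = 5 ∧ walkSign σ p = -1) ∨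
    (∃ (e : Fin n ≃ Fin n) (sw : Fin n → ℝ), (∀ v, sw v = 1 ∨ sw v = -1) ∧
      ∀ i j, A i j = sw i * gamma1 n (e i) (e j) * sw j) := by
  have : NeZero n := ⟨by omega⟩
  have hn3 : 3 ≤ n := by omega
  have hgt := card_sub_three_lt_lam1_gamma1 hn3 hG1
  obtain ⟨z, hz0, hz⟩ := exists_eigenvector_lam1 hA
  obtain ⟨m, hm⟩ := Finite.exists_max fun i => |z i|
  have hzm : 0 < |z m| := by
    obtain ⟨i, hi⟩ := Function.ne_iff.mp hz0
    exact (abs_pos.mpr hi).trans_le (hm i)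
  set s : Fin n → ℝ := fun i => if z i < 0 then -1 else 1 with hs_def
  have hs : ∀ v, s v = 1 ∨ s v = -1 := fun v => by simp only [hs_def]; split_ifs <;> simp
  have sq : ∀ v, s v * s v = 1 := fun v => by rcases hs v with e | e <;> simp [e]
  have habs : ∀ v, |z v| = s v * z v := fun v => by
    simp only [hs_def]
    split_ifs with hv
    · rw [abs_of_neg hv]; ring
    · rw [abs_of_nonneg (not_lt.mp hv)]; ring
  set B : Fin n → Fin n → ℝ := fun i j => s i * A i j * s j with hB
  have hAij : ∀ i j, A i j = if G.Adj i j then σ i j else 0 := fun i j => by rw [hAdef]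
  have hAB : ∀ i j, A i j = s i * B i j * s j := fun i j => by
    simp only [hB]; linear_combination (-A i j * s j * s j) * sq i - A i j * sq j
  have hBadj : ∀ i j, G.Adj i j → B i j = s i * σ i j * s j := fun i j h => by
    simp [hB, hAij, h]
  have hadj : ∀ i j, B i j ≠ 0 → G.Adj i j := fun i j h => by
    by_contra hc
    exact h (by simp [hB, hAij, hc])
  have hBval : ∀ i j, G.Adj i j → B i j = 1 ∨ B i j = -1 := fun i j h => by
    rw [hBadj i j h]
    rcases hs i with e | e <;> rcases hs j with e' | e' <;> rcases hval i j h with e'' | e'' <;>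
      simp [e, e', e'']
  have hdom : IsDominantVector B (fun i => |z i| / |z m|) (lam1 A hA) m :=
    { symm := fun i j => by simp only [hB, hAij, hsym i j, G.adj_comm i j]; ring
      diag := fun i => by simp [hB, hAij]
      entry := fun i j => by
        by_cases h : G.Adj i j
        · exact Or.inr (hBval i j h)
        · exact Or.inl (by_contra fun h' => h (hadj i j h'))
      nonneg := fun i => by positivity
      le_one := fun i => (div_le_one hzm).mpr (hm i)
      max := div_self hzm.ne'
      eigen := fun i => by
        simp only [habs i, mul_div_assoc', ← Finset.sum_div]
        congr 1
        rw [mul_left_comm, hz, Finset.mul_sum]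
        refine Finset.sum_congr rfl fun j _ => ?_
        rw [habs j]
        simp only [hB]
        linear_combination (-s i * A i j * z j) * sq j
      nine_le := by
        have : (12 : ℝ) ≤ n := by exact_mod_cast hn
        linarith
      card_lt := by
        rw [Fintype.card_fin]
        linarith }
  obtain ⟨u, w, huw⟩ : ∃ u w, B u w = -1 := by
    by_contra! hc
    obtain ⟨v, p, -, hp⟩ := hunbal
    rw [walkSign_eq_of_switching hs (fun i j h => by
      rw [← hBadj i j h]
      exact (hBval i j h).resolve_right (hc i j)) p, sq] at hp
    norm_num at hp
  by_cases hP : NoPosPath B u w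
  · right
    obtain ⟨e, he⟩ := hdom.exists_equiv_gamma1 hn3 hG1 hlam huw hP
    exact ⟨e, s, hs, fun i j => by rw [← he, hAB]⟩
  · left
    simp only [NoPosPath, not_forall] at hP
    obtain ⟨a, b, c, hbu, hbw, hac, h1, h2, h3, h4, -⟩ := hP
    have hwu : B w u = -1 := by rw [hdom.symm, huw]
    have edge : ∀ {i j : Fin n}, B i j = 1 → G.Adj i j := fun h => hadj _ _ (by rw [h]; norm_num)
    have hadj' : G.Adj w u := hadj _ _ (by rw [hwu]; norm_num)
    refine exists_negative_pentagon hs (edge h1) (edge h2) (edge h3) (edge h4) hadj' hbu.symm ?_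
      hac ?_ hbw ?_ ?_ ?_ ?_ ?_
    · rintro rfl; rw [h4] at huw; norm_num at huw
    · rintro rfl; rw [h1] at huw; norm_num at huw
    · rw [← hBadj _ _ (edge h1), h1]
    · rw [← hBadj _ _ (edge h2), h2]
    · rw [← hBadj _ _ (edge h3), h3]
    · rw [← hBadj _ _ (edge h4), h4]
    · rw [← hBadj _ _ hadj', hwu]
end
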